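/- (From the proof of Proposition 3.10: regular-value property of φ12 in the 2-2 type case.) Let Q12(l) = [(e^{2l23} + 2e^{l23+l13}·cosh l12 + e^{2l13})·(e^{2l14} + 2e^{l24+l14}·cosh l12 + e^{2l24})]^{1/2}, which does not depend on l34. For every l = (l12, l13, l14, l23, l24, l34) ∈ ℝ^6, the function t ↦ φ12(l12, l13, l14, l23, l24, t) is differentiable at t = l34 with derivative −2·e^{l34}·sinh²(l12) / Q12(l); in particular, this partial derivative is strictly negative whenever l12 ≠ 0, so the total derivative (gradient) of φ12 is nonzero at every point of ℛ. -/

import Mathlib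

open Real

/-- Extended angle-cosine `φ₁₂` of a decorated 2-2 type hyperbolic tetrahedron
(vertices 1,2 hyper-ideal, vertices 3,4 ideal). -/
noncomputable def phi12 (l12 l13 l14 l23 l24 l34 : ℝ) : ℝ :=
  ((exp l13 + exp l23 * cosh l12) * (exp l14 + exp l24 * cosh l12)
      - (2 * exp l34 + exp (l23 + l24)) * (sinh l12) ^ 2) /
    Real.sqrt ((exp (2 * l23) + 2 * exp (l23 + l13) * cosh l12 + exp (2 * l13)) *
      (exp (2 * l14) + 2 * exp (l24 + l14) * cosh l12 + exp (2 * l24)))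

/-- Extended angle-cosine `φ₃₄` of a decorated 2-2 type hyperbolic tetrahedron. -/
noncomputable def phi34 (l12 l13 l14 l23 l24 l34 : ℝ) : ℝ :=
  (exp (l24 + l13) + exp (l14 + l23) - 2 * exp l34 * cosh l12) /
    (2 * Real.sqrt ((exp (l24 + l23) + exp l34) * (exp (l14 + l13) + exp l34)))

/-- Extended angle-cosine `φ_ik` of a decorated 2-2 type hyperbolic tetrahedron, where
`{i,j} = {1,2}`, `{k,h} = {3,4}`, written in the variables
`(l_ij, l_kh, l_ik, l_ih, l_jk, l_jh)`. -/
noncomputable def phiIK (lij lkh lik lih ljk ljh : ℝ) : ℝ :=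
  ((2 * exp (lkh - lik - lih) + 1) * (exp ljk + exp lik * cosh lij)
      - (exp (ljh + lik - lih) + exp lik * cosh lij)) /
    (2 * Real.sqrt ((exp (2 * (lkh - lik - lih)) + exp (lkh - lik - lih)) *
      (exp (2 * ljk) + 2 * exp (lik + ljk) * cosh lij + exp (2 * lik))))

/-- `φ₁₃` : take `i=1, j=2, k=3, h=4`. -/
noncomputable def phi13 (l12 l13 l14 l23 l24 l34 : ℝ) : ℝ :=
  phiIK l12 l34 l13 l14 l23 l24

/-- `φ₁₄` : take `i=1, j=2, k=4, h=3`. -/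
noncomputable def phi14 (l12 l13 l14 l23 l24 l34 : ℝ) : ℝ :=
  phiIK l12 l34 l14 l13 l24 l23

/-- `φ₂₃` : take `i=2, j=1, k=3, h=4`. -/
noncomputable def phi23 (l12 l13 l14 l23 l24 l34 : ℝ) : ℝ :=
  phiIK l12 l34 l23 l24 l13 l14

/-- `φ₂₄` : take `i=2, j=1, k=4, h=3`. -/
noncomputable def phi24 (l12 l13 l14 l23 l24 l34 : ℝ) : ℝ :=
  phiIK l12 l34 l24 l23 l14 l13

/-- The denominator `Q₁₂` of `φ₁₂` in the 2-2 type case; it does not depend on `l34`. -/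
noncomputable def Q12 (l12 l13 l14 l23 l24 : ℝ) : ℝ :=
  Real.sqrt ((exp (2 * l23) + 2 * exp (l23 + l13) * cosh l12 + exp (2 * l13)) *
    (exp (2 * l14) + 2 * exp (l24 + l14) * cosh l12 + exp (2 * l24)))

theorem Q12_pos (l12 l13 l14 l23 l24 : ℝ) : 0 < Q12 l12 l13 l14 l23 l24 := by
  have hc := cosh_pos l12
  unfold Q12
  positivity

/-- Regular-value property of `φ₁₂` in the 2-2 type case (from the proof of
Proposition 3.10): `∂φ₁₂/∂l34 = −2 e^{l34} sinh² l12 / Q₁₂(l)`, which is strictly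
negative whenever `l12 ≠ 0`; hence the gradient of `φ₁₂` is nonzero on `ℛ`. -/
theorem phi12_hasDerivAt_l34 (l12 l13 l14 l23 l24 l34 : ℝ) :
    HasDerivAt (fun t => phi12 l12 l13 l14 l23 l24 t)
      (-2 * exp l34 * (sinh l12) ^ 2 / Q12 l12 l13 l14 l23 l24) l34 ∧
    (l12 ≠ 0 → -2 * exp l34 * (sinh l12) ^ 2 / Q12 l12 l13 l14 l23 l24 < 0) := by
  refine ⟨?_, fun h => div_neg_of_neg_of_pos ?_ (Q12_pos _ _ _ _ _)⟩
  · have hnum := ((((hasDerivAt_exp l34).const_mul 2).add_const (exp (l23 + l24))).mul_const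
      (sinh l12 ^ 2)).const_sub ((exp l13 + exp l23 * cosh l12) * (exp l14 + exp l24 * cosh l12))
    exact (hnum.div_const (Q12 l12 l13 l14 l23 l24)).congr_deriv (by ring)
  · have hs : sinh l12 ≠ 0 := sinh_eq_zero.not.mpr h
    have hpos : 0 < 2 * exp l34 * sinh l12 ^ 2 := by positivity
    linarith
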